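/- Fix integers g ≥ 0, k ≥ 1, n ≥ 1 and a k-tuple 𝛍 = (μ¹,…,μᵏ) of partitions of n with δ(𝛍) ≥ 0. Define W(λ) := (2g−2+k)·n(λ) + (g−1)·n − Σ_{i=1}^k v(λ,μⁱ) for λ ∈ 𝒫ₙ. Then the maximum of W(λ) over λ ∈ 𝒫ₙ equals Δ(𝛍) and is attained at λ = (1ⁿ). Moreover: if δ(𝛍) = 0 and every μⁱ is rectangular, say μⁱ = (tᵢ^{n/tᵢ}), then, with t := gcd(t₁,…,t_k), the maximum is attained exactly at those λ that are the union of n/t copies of a single partition λ₀ of t; otherwise the maximum is attained only at λ = (1ⁿ). -/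

import Mathlib

/-- A partition of `n`: a weakly decreasing, eventually zero sequence of natural
numbers (0-indexed: `parts i` is `λ_{i+1}`) summing to `n`. -/
structure PartitionOf (n : ℕ) where
  parts : ℕ → ℕ
  antitone : ∀ ⦃i j : ℕ⦄, i ≤ j → parts j ≤ parts i
  eventually_zero : ∃ N, ∀ i, N ≤ i → parts i = 0
  sum_eq : ∑ᶠ i, parts i = n

/-- A partition is rectangular if all its (non-zero) parts are equal. -/
def Rectangular {n : ℕ} (lam : PartitionOf n) : Prop :=
  ∀ i j, lam.parts i ≠ 0 → lam.parts j ≠ 0 → lam.parts i = lam.parts j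

/-- The length (number of non-zero parts) of a partition. -/
noncomputable def partLength {n : ℕ} (lam : PartitionOf n) : ℕ :=
  Set.ncard {i | lam.parts i ≠ 0}

/-- `n(λ) = Σ_{i ≥ 1} (i-1)·λ_i` (here 0-indexed, so `Σ_i i·parts i`). -/
noncomputable def nStat {n : ℕ} (lam : PartitionOf n) : ℕ := ∑ᶠ i, i * lam.parts i

/-- The partition `(1ⁿ)` of `n`. -/
def onesPartition (n : ℕ) : PartitionOf n where
  parts i := if i < n then 1 else 0
  antitone := by
    intro i j hij
    by_cases h : j < n
    · simp [h, lt_of_le_of_lt hij h]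
    · simp [h]
  eventually_zero := ⟨n, fun i hi => if_neg (by omega)⟩
  sum_eq := by
    have hsupp : (Function.support fun i => if i < n then 1 else 0) ⊆
        (Finset.range n : Finset ℕ) := by
      intro i hi
      simp only [Function.mem_support, ne_eq, ite_eq_right_iff, not_forall] at hi
      exact Finset.mem_range.mpr hi.1
    rw [finsum_eq_sum_of_support_subset _ hsupp]
    rw [Finset.sum_ite_of_true (by intro i hi; exact Finset.mem_range.mp hi)]
    simp

/-- `ν` is the union of the family of partitions `ρ` (multiset of parts of `ν` is the
disjoint union of those of the `ρ p`), expressed by counting parts of each value. -/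
def IsUnionOf {s : ℕ} {m : Fin s → ℕ} (ρ : ∀ p, PartitionOf (m p)) {n : ℕ}
    (ν : PartitionOf n) : Prop :=
  ∀ v, 0 < v →
    Set.ncard {i | ν.parts i = v} = ∑ p, Set.ncard {i | (ρ p).parts i = v}

/-- `v(λ,μ) = min { n(ρ¹)+⋯+n(ρʳ) : ρᵖ ∈ 𝒫_{μ_p}, ρ¹∪⋯∪ρʳ ⊴ λ }`, where `r` is the
number of parts of `μ`. -/
noncomputable def vStat {n : ℕ} (r : ℕ) (μ lam : PartitionOf n) : ℕ :=
  sInf {t | ∃ ρ : ∀ p : Fin r, PartitionOf (μ.parts p),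
    (∃ νu : PartitionOf n, IsUnionOf ρ νu ∧
      ∀ j, ∑ i ∈ Finset.range j, νu.parts i ≤ ∑ i ∈ Finset.range j, lam.parts i) ∧
    ∑ p, nStat (ρ p) = t}

/-- `Δ(𝛍) = ½(2g−2+k)n² − ½ Σ_{i,j} (μⁱⱼ)²`. -/
noncomputable def DeltaStat (g k : ℕ) {m : ℕ} (ρ : Fin k → PartitionOf m) : ℚ :=
  (2 * (g : ℚ) - 2 + (k : ℚ)) * (m : ℚ) ^ 2 / 2
    - (∑ i, ∑ᶠ j, ((ρ i).parts j : ℚ) ^ 2) / 2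

/-- `δ(𝛍) = (2g−2+k)n − Σ_i μⁱ₁`. -/
noncomputable def deltaStat (g k : ℕ) {m : ℕ} (ρ : Fin k → PartitionOf m) : ℚ :=
  (2 * (g : ℚ) - 2 + (k : ℚ)) * (m : ℚ) - ∑ i, ((ρ i).parts 0 : ℚ)

/-- `W(λ) = (2g−2+k)·n(λ) + (g−1)·n − Σ_i v(λ,μⁱ)`. -/
noncomputable def WVal (g k n : ℕ) (μ : Fin k → PartitionOf n)
    (lam : PartitionOf n) : ℚ :=
  (2 * (g : ℚ) - 2 + (k : ℚ)) * (nStat lam : ℚ) + ((g : ℚ) - 1) * (n : ℚ)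
    - ∑ i, (vStat (partLength (μ i)) (μ i) lam : ℚ)

namespace PartitionOf

variable {m n : ℕ}

theorem sum_range_le (lam : PartitionOf m) (k : ℕ) :
    ∑ i ∈ Finset.range k, lam.parts i ≤ m := by
  obtain ⟨N, hN⟩ := lam.eventually_zero
  have hsupp : (Function.support lam.parts) ⊆ (Finset.range (max N k) : Finset ℕ) := by
    intro i hi
    by_contra h
    simp only [Finset.coe_range, Set.mem_Iio, not_lt] at h
    exact hi (hN i (le_trans (le_max_left _ _) h))
  have h := lam.sum_eq
  rw [finsum_eq_sum_of_support_subset _ hsupp] at h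
  exact (Finset.sum_le_sum_of_subset (Finset.range_mono (le_max_right _ _))).trans_eq h

theorem parts_eq_zero (lam : PartitionOf m) {i : ℕ} (h : m ≤ i) : lam.parts i = 0 := by
  by_contra h0
  have h1 : ∑ _j ∈ Finset.range (i + 1), 1 ≤ ∑ j ∈ Finset.range (i + 1), lam.parts j := by
    refine Finset.sum_le_sum fun j hj => ?_
    have := lam.antitone (Nat.lt_succ_iff.mp (Finset.mem_range.mp hj))
    omega
  have h2 := lam.sum_range_le (i + 1)
  simp at h1
  omega

theorem finsum_eq_sum_range {R : Type*} [AddCommMonoid R] (lam : PartitionOf m) {N : ℕ}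
    (hN : ∀ i, N ≤ i → lam.parts i = 0) (f : ℕ → R) (hf : ∀ i, lam.parts i = 0 → f i = 0) :
    ∑ᶠ i, f i = ∑ i ∈ Finset.range N, f i := by
  apply finsum_eq_sum_of_support_subset
  intro i hi
  by_contra h
  simp only [Finset.coe_range, Set.mem_Iio, not_lt] at h
  exact hi (hf i (hN i h))

theorem sum_range_eq (lam : PartitionOf m) {N : ℕ} (hN : m ≤ N) :
    ∑ i ∈ Finset.range N, lam.parts i = m := by
  rw [← lam.finsum_eq_sum_range (fun i hi => lam.parts_eq_zero (hN.trans hi)) _ fun _ h => h,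
    lam.sum_eq]

theorem parts_le (lam : PartitionOf m) (i : ℕ) : lam.parts i ≤ m :=
  (Finset.single_le_sum (fun _ _ => Nat.zero_le _) (Finset.self_mem_range_succ i)).trans
    (lam.sum_range_le (i + 1))

theorem nStat_eq_sum_range (lam : PartitionOf m) {N : ℕ} (hN : m ≤ N) :
    nStat lam = ∑ i ∈ Finset.range N, i * lam.parts i :=
  lam.finsum_eq_sum_range (fun i hi => lam.parts_eq_zero (hN.trans hi)) _ fun i h => by simp [h]

/-- The (0-indexed) parts of the conjugate partition. -/
noncomputable def conj (lam : PartitionOf m) (j : ℕ) : ℕ := Set.ncard {i | j < lam.parts i}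

theorem lt_conj (lam : PartitionOf m) {i j : ℕ} : i < lam.conj j ↔ j < lam.parts i := by
  classical
  have hex : ∃ i, lam.parts i ≤ j := ⟨m, by simp [lam.parts_eq_zero le_rfl]⟩
  have key : ∀ i, j < lam.parts i ↔ i < Nat.find hex := by
    intro i
    rw [Nat.lt_find_iff]
    refine ⟨fun h l hl => ?_, fun h => not_le.mp (h i le_rfl)⟩
    have := lam.antitone hl
    omega
  have : {i | j < lam.parts i} = ↑(Finset.range (Nat.find hex)) := by
    ext i
    simp only [Set.mem_ofPred_eq, Finset.coe_range, Set.mem_Iio]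
    exact key i
  rw [conj, this, Set.ncard_coe_finset, Finset.card_range, key]

theorem conj_le (lam : PartitionOf m) (j : ℕ) : lam.conj j ≤ m := by
  by_contra! h
  have := lam.lt_conj.mp h
  have := lam.parts_eq_zero le_rfl
  omega

theorem sum_ite_lt_conj {R : Type*} [AddCommMonoid R] (lam : PartitionOf m) {N : ℕ} (hN : m ≤ N)
    (j : ℕ) (f : ℕ → R) :
    ∑ i ∈ Finset.range (lam.conj j), f i =
      ∑ i ∈ Finset.range N, if j < lam.parts i then f i else 0 := by
  rw [← Finset.sum_filter]
  congr 1
  ext i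
  have := lam.conj_le j
  simp only [Finset.mem_range, Finset.mem_filter, lt_conj]
  refine ⟨fun h => ⟨?_, h⟩, fun h => h.2⟩
  have := lam.lt_conj.mpr h
  omega

theorem sum_range_conj_sum {R : Type*} [CommSemiring R] (lam : PartitionOf m) {N : ℕ}
    (hN : m ≤ N) (f : ℕ → R) :
    ∑ j ∈ Finset.range N, ∑ i ∈ Finset.range (lam.conj j), f i =
      ∑ i ∈ Finset.range N, lam.parts i * f i := by
  simp_rw [lam.sum_ite_lt_conj hN]
  rw [Finset.sum_comm]
  refine Finset.sum_congr rfl fun i _ => ?_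
  rw [← Finset.sum_filter, Finset.sum_const, nsmul_eq_mul]
  congr 2
  have : (Finset.range N).filter (fun j => j < lam.parts i) = Finset.range (lam.parts i) := by
    ext j
    have := lam.parts_le i
    simp only [Finset.mem_filter, Finset.mem_range]
    omega
  rw [this, Finset.card_range]

theorem sum_conj (lam : PartitionOf m) {N : ℕ} (hN : m ≤ N) :
    ∑ j ∈ Finset.range N, lam.conj j = m := by
  have := lam.sum_range_conj_sum hN fun _ => 1
  simpa [lam.sum_range_eq hN] using this

theorem sum_conj_sq (lam : PartitionOf m) {N : ℕ} (hN : m ≤ N) :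
    ∑ j ∈ Finset.range N, lam.conj j ^ 2 = 2 * nStat lam + m := by
  have h := lam.sum_range_conj_sum hN fun i => 2 * i + 1
  have hodd : ∀ c : ℕ, ∑ i ∈ Finset.range c, (2 * i + 1) = c ^ 2 := by
    intro c
    induction c with
    | zero => simp
    | succ c ih => rw [Finset.sum_range_succ, ih]; ring
  simp_rw [hodd] at h
  rw [h, lam.nStat_eq_sum_range hN]
  refine Eq.trans ?_ (congrArg _ (lam.sum_range_eq hN))
  rw [Finset.mul_sum, ← Finset.sum_add_distrib]
  exact Finset.sum_congr rfl fun i _ => by push_cast; ring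

theorem conj_eq_sum_ncard (lam : PartitionOf m) {N : ℕ} (hN : m ≤ N) (j : ℕ) :
    lam.conj j = ∑ v ∈ Finset.Ioc j N, Set.ncard {i | lam.parts i = v} := by
  have hc : ∀ v, 0 < v → Set.ncard {i | lam.parts i = v} =
      ((Finset.range m).filter fun i => lam.parts i = v).card := by
    intro v hv
    rw [← Set.ncard_coe_finset]
    congr 1
    ext i
    simp only [Set.mem_ofPred_eq, Finset.coe_filter, Finset.mem_range]
    refine ⟨fun h => ⟨?_, h⟩, fun h => h.2⟩
    by_contra! h'
    have := lam.parts_eq_zero h'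
    omega
  rw [Finset.sum_congr rfl fun v hv => hc v (by simp only [Finset.mem_Ioc] at hv; omega)]
  have h1 : lam.conj j = ((Finset.range m).filter fun i => j < lam.parts i).card := by
    rw [Finset.card_filter, ← lam.sum_ite_lt_conj le_rfl j fun _ => 1, Finset.sum_const,
      Finset.card_range, smul_eq_mul, mul_one]
  rw [h1, Finset.card_eq_sum_card_fiberwise (t := Finset.Ioc j N) (f := lam.parts)]
  · refine Finset.sum_congr rfl fun v hv => ?_
    congr 1
    ext i
    simp only [Finset.mem_Ioc] at hv
    simp only [Finset.mem_filter, Finset.mem_range]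
    refine ⟨fun h => ⟨h.1.1, h.2⟩, fun h => ⟨⟨h.1, by omega⟩, h.2⟩⟩
  · intro i hi
    have := lam.parts_le i
    simp only [Finset.coe_filter, Set.mem_ofPred_eq] at hi
    simp only [Finset.coe_Ioc, Set.mem_Ioc]
    omega

theorem lt_partLength (lam : PartitionOf m) {i : ℕ} : i < partLength lam ↔ 0 < lam.parts i := by
  have : partLength lam = lam.conj 0 := by
    simp only [partLength, conj, Nat.pos_iff_ne_zero]
  rw [this, lt_conj]

theorem parts_eq_zero_of_partLength_le (lam : PartitionOf m) {i : ℕ} (h : partLength lam ≤ i) :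
    lam.parts i = 0 := by
  by_contra h0
  have := lam.lt_partLength.mpr (Nat.pos_of_ne_zero h0)
  omega

theorem sum_fin_parts (lam : PartitionOf m) :
    ∑ p : Fin (partLength lam), lam.parts p = m := by
  rw [Fin.sum_univ_eq_sum_range (fun i => lam.parts i),
    ← lam.finsum_eq_sum_range (fun i hi => lam.parts_eq_zero_of_partLength_le hi) _ fun _ h => h,
    lam.sum_eq]

theorem finsum_parts_sq (lam : PartitionOf m) :
    ∑ᶠ j, (lam.parts j : ℚ) ^ 2 = ∑ p : Fin (partLength lam), (lam.parts p : ℚ) ^ 2 := by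
  rw [Fin.sum_univ_eq_sum_range (fun i => (lam.parts i : ℚ) ^ 2)]
  exact lam.finsum_eq_sum_range (fun i hi => lam.parts_eq_zero_of_partLength_le hi) _
    fun i h => by simp [h]

theorem nStat_add_sum_partialSums (lam : PartitionOf n) :
    nStat lam + ∑ j ∈ Finset.range n, ∑ i ∈ Finset.range (j + 1), lam.parts i = n * n := by
  have key : ∀ (a : ℕ → ℕ) (N : ℕ), ∑ i ∈ Finset.range N, i * a i +
      ∑ j ∈ Finset.range N, ∑ i ∈ Finset.range (j + 1), a i =
        N * ∑ i ∈ Finset.range N, a i := by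
    intro a N
    induction N with
    | zero => simp
    | succ N ih =>
      rw [Finset.sum_range_succ, Finset.sum_range_succ (fun j => ∑ i ∈ Finset.range (j + 1), a i),
        Finset.sum_range_succ a N]
      linarith
  rw [lam.nStat_eq_sum_range le_rfl, key, lam.sum_range_eq le_rfl]

theorem nStat_le_of_dominates {lam nu : PartitionOf n}
    (h : ∀ j, ∑ i ∈ Finset.range j, nu.parts i ≤ ∑ i ∈ Finset.range j, lam.parts i) :
    nStat lam ≤ nStat nu := by
  have h1 := lam.nStat_add_sum_partialSums
  have h2 := nu.nStat_add_sum_partialSums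
  have h3 := Finset.sum_le_sum fun j (_ : j ∈ Finset.range n) => h (j + 1)
  omega

theorem parts_eq_of_dominates_of_nStat_eq {lam nu : PartitionOf n}
    (h : ∀ j, ∑ i ∈ Finset.range j, nu.parts i ≤ ∑ i ∈ Finset.range j, lam.parts i)
    (he : nStat lam = nStat nu) : lam.parts = nu.parts := by
  have h1 := lam.nStat_add_sum_partialSums
  have h2 := nu.nStat_add_sum_partialSums
  have h3 := (Finset.sum_eq_sum_iff_of_le fun j (_ : j ∈ Finset.range n) => h (j + 1)).mp
    (by omega)
  have h4 : ∀ j ≤ n, ∑ i ∈ Finset.range j, nu.parts i = ∑ i ∈ Finset.range j, lam.parts i := by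
    rintro (_ | j) hj
    · simp
    · exact h3 j (Finset.mem_range.mpr hj)
  funext i
  by_cases hi : i < n
  · have h5 := h4 (i + 1) hi
    rw [Finset.sum_range_succ, Finset.sum_range_succ, h4 i hi.le] at h5
    omega
  · rw [lam.parts_eq_zero (not_lt.mp hi), nu.parts_eq_zero (not_lt.mp hi)]

theorem ones_dominated (lam : PartitionOf n) (j : ℕ) :
    ∑ i ∈ Finset.range j, (onesPartition n).parts i ≤ ∑ i ∈ Finset.range j, lam.parts i := by
  induction j with
  | zero => simp
  | succ j ih =>
    by_cases hj : 0 < lam.parts j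
    · rw [Finset.sum_range_succ, Finset.sum_range_succ]
      refine add_le_add ih ?_
      simp only [onesPartition]
      split_ifs <;> omega
    · have h0 : ∀ i, j ≤ i → lam.parts i = 0 := fun i hi => by
        have := lam.antitone hi
        omega
      have h1 := lam.finsum_eq_sum_range (N := j + 1) (fun i hi => h0 i (by omega)) _ fun _ h => h
      rw [lam.sum_eq] at h1
      rw [← h1]
      exact sum_range_le _ _

theorem two_mul_nStat_ones (n : ℕ) : 2 * nStat (onesPartition n) + n = n ^ 2 := by
  have h := (onesPartition n).nStat_add_sum_partialSums
  rw [nStat_eq_sum_range _ le_rfl]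
  have h1 : ∑ i ∈ Finset.range n, i * (onesPartition n).parts i = ∑ i ∈ Finset.range n, i :=
    Finset.sum_congr rfl fun i hi => by simp [onesPartition, Finset.mem_range.mp hi]
  rw [h1, mul_comm, Finset.sum_range_id_mul_two]
  cases n with
  | zero => simp
  | succ n => simp; ring

theorem two_mul_nStat_add_le (lam : PartitionOf n) : 2 * nStat lam + n ≤ n ^ 2 := by
  have := nStat_le_of_dominates lam.ones_dominated
  have := two_mul_nStat_ones n
  omega

theorem parts_eq_ones (lam : PartitionOf n) (h : 2 * nStat lam + n = n ^ 2) :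
    lam.parts = (onesPartition n).parts := by
  refine parts_eq_of_dominates_of_nStat_eq lam.ones_dominated ?_
  have := two_mul_nStat_ones n
  omega

theorem conj_eq_sum_of_isUnionOf {s : ℕ} {a : Fin s → ℕ} {ρ : ∀ p, PartitionOf (a p)}
    {nu : PartitionOf n} (h : IsUnionOf ρ nu) (ha : ∀ p, a p ≤ n) (j : ℕ) :
    nu.conj j = ∑ p, (ρ p).conj j := by
  rw [nu.conj_eq_sum_ncard le_rfl]
  simp_rw [fun p => (ρ p).conj_eq_sum_ncard (ha p)]
  rw [Finset.sum_comm]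
  exact Finset.sum_congr rfl fun v hv => h v (by simp only [Finset.mem_Ioc] at hv; omega)

theorem ncard_ones (n v : ℕ) (hv : 0 < v) :
    Set.ncard {i | (onesPartition n).parts i = v} = if v = 1 then n else 0 := by
  split_ifs with h
  · subst h
    have : {i | (onesPartition n).parts i = 1} = ↑(Finset.range n) := by
      ext i
      simp [onesPartition]
    rw [this, Set.ncard_coe_finset, Finset.card_range]
  · have : {i | (onesPartition n).parts i = v} = ∅ := by
      ext i
      simp only [onesPartition, Set.mem_ofPred_eq, Set.mem_empty_iff_false, iff_false]
      split_ifs <;> omega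
    rw [this, Set.ncard_empty]

theorem isUnionOf_ones {s : ℕ} {a : Fin s → ℕ} (h : ∑ p, a p = n) :
    IsUnionOf (fun p => onesPartition (a p)) (onesPartition n) := by
  intro v hv
  simp_rw [ncard_ones _ v hv]
  split_ifs <;> simp [h]

theorem weighted_sq_identity {ι κ : Type*} [Fintype ι] (J : Finset κ) (s : ι → κ → ℚ)
    (w : ι → ℚ) (hw : ∀ p, 0 < w p) (a N : ℚ) (hN : N ≠ 0) (hsum : ∑ p, w p = N) :
    a * (N ^ 2 - ∑ j ∈ J, (∑ p, s p j) ^ 2) - N * ∑ p, (w p ^ 2 - ∑ j ∈ J, s p j ^ 2) =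
      N * ∑ p, (a / w p - 1) * (w p ^ 2 - ∑ j ∈ J, s p j ^ 2) +
        a * N * ∑ j ∈ J, ∑ p, w p * (s p j / w p - (∑ q, s q j) / N) ^ 2 := by
  have h1 : ∀ j, ∑ p, w p * (s p j / w p - (∑ q, s q j) / N) ^ 2 =
      ∑ p, s p j ^ 2 / w p - (∑ q, s q j) ^ 2 / N := by
    intro j
    set σ := ∑ q, s q j with hσ
    have : ∀ p, w p * (s p j / w p - σ / N) ^ 2 =
        s p j ^ 2 / w p - 2 * (σ / N) * s p j + (σ / N) ^ 2 * w p := by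
      intro p
      have := (hw p).ne'
      field_simp
      ring
    simp_rw [this]
    rw [Finset.sum_add_distrib, Finset.sum_sub_distrib, ← Finset.mul_sum, ← Finset.mul_sum,
      hsum, ← hσ]
    field_simp
    ring1
  simp_rw [h1]
  have h2 : ∀ p, (a / w p - 1) * (w p ^ 2 - ∑ j ∈ J, s p j ^ 2) =
      a * w p - a * (∑ j ∈ J, s p j ^ 2 / w p) - (w p ^ 2 - ∑ j ∈ J, s p j ^ 2) := by
    intro p
    have := (hw p).ne'
    rw [← Finset.sum_div]
    field_simp
  simp_rw [h2, Finset.sum_sub_distrib, ← Finset.mul_sum, hsum, ← Finset.sum_div]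
  rw [Finset.sum_comm' (s := J) (t' := Finset.univ) (s' := fun _ => J) (by simp)]
  simp_rw [← Finset.sum_div]
  field_simp
  ring

/-- The choice `ρᵖ = (1^{μ_p})` is admissible for every `lam`. -/
theorem vStat_le_ones (mu lam : PartitionOf n) :
    vStat (partLength mu) mu lam ≤
      ∑ p : Fin (partLength mu), nStat (onesPartition (mu.parts p)) :=
  Nat.sInf_le ⟨_, ⟨onesPartition n, isUnionOf_ones mu.sum_fin_parts, lam.ones_dominated⟩, rfl⟩

theorem exists_eq_vStat (mu lam : PartitionOf n) :
    ∃ ρ : ∀ p : Fin (partLength mu), PartitionOf (mu.parts p),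
      (∃ nu : PartitionOf n, IsUnionOf ρ nu ∧
        ∀ j, ∑ i ∈ Finset.range j, nu.parts i ≤ ∑ i ∈ Finset.range j, lam.parts i) ∧
      ∑ p, nStat (ρ p) = vStat (partLength mu) mu lam := by
  have hne : {t | ∃ ρ : ∀ p : Fin (partLength mu), PartitionOf (mu.parts p),
      (∃ nu : PartitionOf n, IsUnionOf ρ nu ∧
        ∀ j, ∑ i ∈ Finset.range j, nu.parts i ≤ ∑ i ∈ Finset.range j, lam.parts i) ∧
      ∑ p, nStat (ρ p) = t}.Nonempty :=
    ⟨_, _, ⟨onesPartition n, isUnionOf_ones mu.sum_fin_parts, lam.ones_dominated⟩, rfl⟩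
  exact Nat.sInf_mem hne

/-- The sum of the squares of the parts of the conjugate of `lam`. -/
noncomputable def conjSq (lam : PartitionOf n) : ℚ := 2 * nStat lam + n

theorem conjSq_eq (lam : PartitionOf m) (h : m ≤ n) :
    lam.conjSq = ∑ j ∈ Finset.range n, (lam.conj j : ℚ) ^ 2 := by
  have := lam.sum_conj_sq h
  rw [conjSq]
  exact_mod_cast this.symm

theorem conjSq_le (lam : PartitionOf n) : lam.conjSq ≤ (n : ℚ) ^ 2 := by
  have := lam.two_mul_nStat_add_le
  rw [conjSq]
  exact_mod_cast this

theorem parts_eq_ones_of_conjSq_eq (lam : PartitionOf n) (h : lam.conjSq = (n : ℚ) ^ 2) :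
    lam.parts = (onesPartition n).parts :=
  lam.parts_eq_ones (by rw [conjSq] at h; exact_mod_cast h)

theorem conjSq_ones (n : ℕ) : (onesPartition n).conjSq = (n : ℚ) ^ 2 := by
  rw [conjSq]
  exact_mod_cast two_mul_nStat_ones n

theorem sum_fin_parts_cast (mu : PartitionOf n) :
    ∑ p : Fin (partLength mu), (mu.parts p : ℚ) = n := by
  exact_mod_cast mu.sum_fin_parts

theorem two_mul_sum_nStat_add (mu : PartitionOf n)
    (ρ : ∀ p : Fin (partLength mu), PartitionOf (mu.parts p)) :
    2 * ((∑ p, nStat (ρ p) : ℕ) : ℚ) + n = ∑ p, (ρ p).conjSq := by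
  simp only [conjSq]
  rw [Finset.sum_add_distrib, ← Finset.mul_sum, mu.sum_fin_parts_cast]
  push_cast
  rfl

theorem parts_zero_pos (mu : PartitionOf n) (hn : 0 < n) : 0 < mu.parts 0 := by
  by_contra! h
  have h1 := mu.sum_range_eq le_rfl
  rw [Finset.sum_eq_zero fun i _ => by have := mu.antitone (Nat.zero_le i); omega] at h1
  omega

/-- The slack in `n (Σ μ_p² - (2 v(λ,μ) + n)) ≤ μ₁ (n² - (2 n(λ) + n))`. -/
noncomputable def slack (mu lam : PartitionOf n) : ℚ :=
  mu.parts 0 * ((n : ℚ) ^ 2 - lam.conjSq) -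
    n * (∑ p : Fin (partLength mu), (mu.parts p : ℚ) ^ 2 -
      (2 * (vStat (partLength mu) mu lam : ℚ) + n))

theorem slack_nonneg_and (hn : 0 < n) (mu lam : PartitionOf n) :
    0 ≤ slack mu lam ∧ (slack mu lam = 0 → lam.conjSq ≠ (n : ℚ) ^ 2 →
      Rectangular mu ∧ ∀ j, partLength mu ∣ lam.conj j) := by
  obtain ⟨ρ, ⟨nu, hU, hdom⟩, hv⟩ := exists_eq_vStat mu lam
  have hnQ : (0 : ℚ) < n := by exact_mod_cast hn
  have ha : (0 : ℚ) < mu.parts 0 := by exact_mod_cast mu.parts_zero_pos hn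
  have hw : ∀ p : Fin (partLength mu), (0 : ℚ) < mu.parts p := fun p => by
    exact_mod_cast mu.lt_partLength.mp p.2
  have hwa : ∀ p : Fin (partLength mu), (mu.parts p : ℚ) ≤ mu.parts 0 := fun p => by
    exact_mod_cast mu.antitone (Nat.zero_le _)
  have hconj : ∀ j, nu.conj j = ∑ p, (ρ p).conj j :=
    conj_eq_sum_of_isUnionOf hU fun p => mu.parts_le p
  have hid := weighted_sq_identity (Finset.range n) (fun p j => ((ρ p).conj j : ℚ))
    (fun p : Fin (partLength mu) => (mu.parts p : ℚ)) hw (mu.parts 0) n hnQ.ne'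
    mu.sum_fin_parts_cast
  have hcast : ∀ j, ∑ p, ((ρ p).conj j : ℚ) = nu.conj j := fun j => by
    rw [hconj]
    push_cast
    rfl
  simp only [hcast, ← nu.conjSq_eq le_rfl, ← fun p => (ρ p).conjSq_eq (mu.parts_le p)] at hid
  set A := ∑ p : Fin (partLength mu), ((mu.parts 0 : ℚ) / mu.parts p - 1) *
    ((mu.parts p : ℚ) ^ 2 - (ρ p).conjSq) with hA
  set B := ∑ j ∈ Finset.range n, ∑ p : Fin (partLength mu),
    (mu.parts p : ℚ) * (((ρ p).conj j : ℚ) / mu.parts p - (nu.conj j : ℚ) / n) ^ 2 with hB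
  have hAterm : ∀ p ∈ (Finset.univ : Finset (Fin (partLength mu))),
      0 ≤ ((mu.parts 0 : ℚ) / mu.parts p - 1) *
      ((mu.parts p : ℚ) ^ 2 - (ρ p).conjSq) := fun p _ =>
    mul_nonneg (sub_nonneg.mpr ((one_le_div (hw p)).mpr (hwa p)))
      (sub_nonneg.mpr (ρ p).conjSq_le)
  have hBterm : ∀ j, ∀ p ∈ (Finset.univ : Finset (Fin (partLength mu))),
      0 ≤ (mu.parts p : ℚ) *
      (((ρ p).conj j : ℚ) / mu.parts p - (nu.conj j : ℚ) / n) ^ 2 := fun _ p _ =>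
    mul_nonneg (hw p).le (sq_nonneg _)
  have hA0 : 0 ≤ A := Finset.sum_nonneg hAterm
  have hB0 : 0 ≤ B := Finset.sum_nonneg fun j _ => Finset.sum_nonneg (hBterm j)
  have hE : slack mu lam = mu.parts 0 * (nu.conjSq - lam.conjSq) +
      (n * A + mu.parts 0 * n * B) := by
    rw [← hid, slack, ← hv, two_mul_sum_nStat_add, Finset.sum_sub_distrib]
    ring
  have hQ : lam.conjSq ≤ nu.conjSq := by
    have := nStat_le_of_dominates hdom
    simp only [conjSq]
    gcongr
  have hnA : 0 ≤ n * A := mul_nonneg hnQ.le hA0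
  have hnB : 0 ≤ mu.parts 0 * n * B := mul_nonneg (mul_nonneg ha.le hnQ.le) hB0
  have hQ' : 0 ≤ mu.parts 0 * (nu.conjSq - lam.conjSq) :=
    mul_nonneg ha.le (sub_nonneg.mpr hQ)
  refine ⟨by rw [hE]; positivity, fun h0 hne => ?_⟩
  rw [hE] at h0
  have hQeq : nu.conjSq = lam.conjSq := by
    have : mu.parts 0 * (nu.conjSq - lam.conjSq) = 0 := by linarith
    simpa [ha.ne', sub_eq_zero] using this
  have hAeq : A = 0 := by
    have : n * A = 0 := by linarith
    simpa [hnQ.ne'] using this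
  have hBeq : B = 0 := by
    have : mu.parts 0 * n * B = 0 := by linarith
    simpa [hnQ.ne', ha.ne'] using this
  have hparts : lam.parts = nu.parts := by
    refine parts_eq_of_dominates_of_nStat_eq hdom ?_
    simp only [conjSq] at hQeq
    have : (nStat lam : ℚ) = nStat nu := by linarith
    exact_mod_cast this
  have hconj' : ∀ j, lam.conj j = nu.conj j := fun j => by rw [conj, conj, hparts]
  have hBt : ∀ j p, ((ρ p).conj j : ℚ) = mu.parts p * ((nu.conj j : ℚ) / n) := by
    intro j p
    by_cases hj : j < n
    · have h1 := (Finset.sum_eq_zero_iff_of_nonneg fun j _ =>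
        Finset.sum_nonneg (hBterm j)).mp hBeq j (Finset.mem_range.mpr hj)
      have h2 := (Finset.sum_eq_zero_iff_of_nonneg (hBterm j)).mp h1 p (Finset.mem_univ p)
      have h3 := (mul_eq_zero.mp h2).resolve_left (hw p).ne'
      have h4 := sub_eq_zero.mp (pow_eq_zero_iff two_ne_zero |>.mp h3)
      rw [← h4, mul_div_cancel₀ _ (hw p).ne']
    · have hz : ∀ {l : ℕ} (τ : PartitionOf l), l ≤ n → τ.conj j = 0 := fun τ hl => by
        by_contra h
        have h1 := τ.lt_conj.mp (Nat.pos_of_ne_zero h)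
        have := τ.parts_le 0
        omega
      simp [hz nu le_rfl, hz (ρ p) (mu.parts_le p)]
  have hpa : ∀ p : Fin (partLength mu), mu.parts p = mu.parts 0 := by
    intro p
    have h1 := (Finset.sum_eq_zero_iff_of_nonneg hAterm).mp hAeq p (Finset.mem_univ p)
    have h2 : (mu.parts p : ℚ) ^ 2 - (ρ p).conjSq ≠ 0 := by
      rw [(ρ p).conjSq_eq (mu.parts_le p)]
      simp only [hBt, mul_pow, div_pow]
      rw [← Finset.mul_sum, ← Finset.sum_div, ← nu.conjSq_eq le_rfl, hQeq]
      intro h3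
      apply hne
      have := (hw p).ne'
      field_simp at h3
      rw [mul_zero] at h3
      have h4 := (mul_eq_zero.mp h3).resolve_left (pow_ne_zero 2 this)
      linarith
    have h3 := (mul_eq_zero.mp h1).resolve_right h2
    have := (hw p).ne'
    field_simp at h3
    have h4 : (mu.parts p : ℚ) = mu.parts 0 := by linarith
    exact_mod_cast h4
  refine ⟨fun i j hi hj => ?_, fun j => ?_⟩
  · rw [hpa ⟨i, mu.lt_partLength.mpr (Nat.pos_of_ne_zero hi)⟩,
      hpa ⟨j, mu.lt_partLength.mpr (Nat.pos_of_ne_zero hj)⟩]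
  · have hr := mu.lt_partLength.mpr (mu.parts_zero_pos hn)
    refine ⟨(ρ ⟨0, hr⟩).conj j, ?_⟩
    have hsum := mu.sum_fin_parts_cast
    simp only [hpa, Finset.sum_const, Finset.card_univ, Fintype.card_fin, nsmul_eq_mul] at hsum
    have h1 := hBt j ⟨0, hr⟩
    rw [hconj' j]
    have h2 : (nu.conj j : ℚ) = partLength mu * (ρ ⟨0, hr⟩).conj j := by
      rw [h1, ← mul_assoc]
      simp only [hsum]
      field_simp
    exact_mod_cast h2

/-- Repeat every part `d` times. -/
def replicate (d : ℕ) (hd : 0 < d) (lam : PartitionOf m) (n : ℕ) (h : n = d * m) :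
    PartitionOf n where
  parts i := lam.parts (i / d)
  antitone _ _ hij := lam.antitone (Nat.div_le_div_right hij)
  eventually_zero := by
    obtain ⟨N, hN⟩ := lam.eventually_zero
    exact ⟨d * N, fun i hi => hN _ ((Nat.le_div_iff_mul_le hd).mpr (by linarith))⟩
  sum_eq := by
    have hsupp : (Function.support fun i => lam.parts (i / d)) ⊆
        (Finset.range (d * m) : Set ℕ) := by
      intro i hi
      by_contra h
      simp only [Finset.coe_range, Set.mem_Iio, not_lt] at h
      exact hi (lam.parts_eq_zero ((Nat.le_div_iff_mul_le hd).mpr (by linarith)))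
    rw [finsum_eq_sum_of_support_subset _ hsupp]
    have key : ∀ N, ∑ i ∈ Finset.range (d * N), lam.parts (i / d) =
        d * ∑ i ∈ Finset.range N, lam.parts i := by
      intro N
      induction N with
      | zero => simp
      | succ N ih =>
        rw [Nat.mul_succ, Finset.sum_range_add, ih, Finset.sum_range_succ, mul_add]
        congr 1
        rw [Finset.sum_congr rfl fun i hi => by
          rw [Nat.mul_add_div hd, Nat.div_eq_of_lt (Finset.mem_range.mp hi), add_zero]]
        simp
    rw [key, lam.sum_range_eq le_rfl, h]

theorem ncard_preimage_div (d : ℕ) (hd : 0 < d) (s : Set ℕ) (hs : s.Finite) :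
    Set.ncard {i | i / d ∈ s} = d * s.ncard := by
  lift s to Finset ℕ using hs
  have : {i | i / d ∈ (s : Set ℕ)} =
      ↑((s ×ˢ Finset.range d).image fun x : ℕ × ℕ => d * x.1 + x.2) := by
    ext i
    simp only [Set.mem_ofPred_eq, Finset.mem_coe, Finset.mem_image, Finset.mem_product,
      Finset.mem_range, Prod.exists]
    constructor
    · intro h
      exact ⟨i / d, i % d, ⟨h, Nat.mod_lt _ hd⟩, Nat.div_add_mod _ _⟩
    · rintro ⟨a, b, ⟨h, hb⟩, rfl⟩
      rwa [Nat.mul_add_div hd, Nat.div_eq_of_lt hb, add_zero]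
  rw [this, Set.ncard_coe_finset, Set.ncard_coe_finset, Finset.card_image_of_injOn,
    Finset.card_product, Finset.card_range, mul_comm]
  rintro ⟨a, b⟩ h ⟨a', b'⟩ h' he
  simp only [Finset.coe_product, Set.mem_prod, Finset.mem_coe, Finset.mem_range] at h h'
  simp only at he
  have h1 := congrArg (· / d) he
  simp only [Nat.mul_add_div hd, Nat.div_eq_of_lt h.2, Nat.div_eq_of_lt h'.2, add_zero] at h1
  subst h1
  simp only [Prod.mk.injEq, true_and]
  omega

theorem finite_parts_eq (lam : PartitionOf m) {v : ℕ} (hv : 0 < v) :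
    {i | lam.parts i = v}.Finite := by
  refine (Set.finite_lt_nat m).subset fun i hi => ?_
  simp only [Set.mem_ofPred_eq] at hi ⊢
  by_contra! h
  have := lam.parts_eq_zero h
  omega

theorem ncard_replicate (d : ℕ) (hd : 0 < d) (lam : PartitionOf m) (n : ℕ) (h : n = d * m)
    {v : ℕ} (hv : 0 < v) :
    Set.ncard {i | (lam.replicate d hd n h).parts i = v} =
      d * Set.ncard {i | lam.parts i = v} :=
  ncard_preimage_div d hd _ (lam.finite_parts_eq hv)

theorem conj_eq_mul_of_ncard {lam0 : PartitionOf m} {lam : PartitionOf n} {d : ℕ} (hmn : m ≤ n)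
    (h : ∀ v, 0 < v → Set.ncard {i | lam.parts i = v} = d * Set.ncard {i | lam0.parts i = v})
    (j : ℕ) : lam.conj j = d * lam0.conj j := by
  rw [lam.conj_eq_sum_ncard le_rfl, lam0.conj_eq_sum_ncard hmn, Finset.mul_sum]
  exact Finset.sum_congr rfl fun v hv => h v (by simp only [Finset.mem_Ioc] at hv; omega)

theorem conjSq_eq_of_ncard {lam0 : PartitionOf m} {lam : PartitionOf n} {d : ℕ} (hmn : m ≤ n)
    (h : ∀ v, 0 < v → Set.ncard {i | lam.parts i = v} = d * Set.ncard {i | lam0.parts i = v}) :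
    lam.conjSq = d ^ 2 * lam0.conjSq := by
  rw [lam.conjSq_eq le_rfl, lam0.conjSq_eq hmn, Finset.mul_sum]
  refine Finset.sum_congr rfl fun j _ => ?_
  rw [conj_eq_mul_of_ncard hmn h j]
  push_cast
  ring

/-- A partition all of whose conjugate parts are divisible by `e` is the union of `e` copies of
a single partition. -/
theorem exists_ncard_eq_mul (lam : PartitionOf n) {e : ℕ} (he : 0 < e) (hn : n = e * m)
    (h : ∀ j, e ∣ lam.conj j) :
    ∃ lam0 : PartitionOf m,
      ∀ v, 0 < v → Set.ncard {i | lam.parts i = v} = e * Set.ncard {i | lam0.parts i = v} := by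
  have hblock : ∀ i, lam.parts i = lam.parts (e * (i / e)) := by
    intro i
    refine le_antisymm (lam.antitone (Nat.mul_div_le i e)) ?_
    by_contra! hlt
    obtain ⟨q, hq⟩ := h (lam.parts i)
    rw [← lam.lt_conj, hq] at hlt
    have h1 : i / e < q := Nat.lt_of_mul_lt_mul_left hlt
    have h2 : i < e * q := by
      rw [mul_comm]
      exact (Nat.div_lt_iff_lt_mul he).mp h1
    rw [← hq, lam.lt_conj] at h2
    exact lt_irrefl _ h2
  have hzero : ∀ i, n ≤ i → lam.parts (e * i) = 0 := fun i hi =>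
    lam.parts_eq_zero (hi.trans (Nat.le_mul_of_pos_left i he))
  let aux : PartitionOf (∑ᶠ i, lam.parts (e * i)) :=
    { parts := fun i => lam.parts (e * i)
      antitone := fun _ _ hij => lam.antitone (Nat.mul_le_mul_left e hij)
      eventually_zero := ⟨n, hzero⟩
      sum_eq := rfl }
  have hrep : (aux.replicate e he _ rfl).parts = lam.parts := funext fun i => (hblock i).symm
  have hsum : ∑ᶠ i, lam.parts (e * i) = m := by
    have h1 := (aux.replicate e he _ rfl).sum_eq
    rw [hrep] at h1
    exact Nat.eq_of_mul_eq_mul_left he (h1.symm.trans (lam.sum_eq.trans hn))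
  refine ⟨⟨aux.parts, aux.antitone, aux.eventually_zero, hsum⟩, fun v hv => ?_⟩
  have := aux.ncard_replicate e he _ rfl hv
  rwa [hrep] at this

theorem conj_ones_dvd {e : ℕ} {lam : PartitionOf n} (h : lam.parts = (onesPartition n).parts)
    (he : e ∣ n) (j : ℕ) : e ∣ lam.conj j := by
  have : lam.conj j = (onesPartition n).conj j := by rw [conj, conj, h]
  rw [this, (onesPartition n).conj_eq_sum_ncard le_rfl]
  refine Finset.dvd_sum fun v hv => ?_
  rw [ncard_ones _ _ (by simp only [Finset.mem_Ioc] at hv; omega)]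
  split_ifs
  exacts [he, dvd_zero e]

theorem parts_eq_of_rectangular {mu : PartitionOf n} (h : Rectangular mu)
    (p : Fin (partLength mu)) : mu.parts p = mu.parts 0 := by
  have hp := mu.lt_partLength.mp p.2
  have := mu.antitone (Nat.zero_le p)
  exact h _ _ (by omega) (by omega)

theorem partLength_mul_of_rectangular {mu : PartitionOf n} (h : Rectangular mu) :
    partLength mu * mu.parts 0 = n := by
  conv_rhs => rw [← mu.sum_fin_parts]
  simp [parts_eq_of_rectangular h]

theorem vStat_le_of_replicate {mu : PartitionOf n} (h : Rectangular mu) {lam : PartitionOf n}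
    {lam0 : PartitionOf m} {d : ℕ} (hd : 0 < d) (hdm : mu.parts 0 = d * m)
    (hc : ∀ v, 0 < v → Set.ncard {i | lam.parts i = v} =
      (partLength mu * d) * Set.ncard {i | lam0.parts i = v}) :
    2 * (vStat (partLength mu) mu lam : ℚ) + n ≤ partLength mu * (d ^ 2 * lam0.conjSq) := by
  have hp : ∀ p : Fin (partLength mu), mu.parts p = d * m := fun p =>
    (parts_eq_of_rectangular h p).trans hdm
  have hle : vStat (partLength mu) mu lam ≤
      ∑ p : Fin (partLength mu), nStat (lam0.replicate d hd (mu.parts p) (hp p)) := by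
    refine Nat.sInf_le ⟨_, ⟨lam, fun v hv => ?_, fun j => le_rfl⟩, rfl⟩
    simp_rw [ncard_replicate d hd lam0 _ _ hv, hc v hv]
    simp [mul_assoc]
  have hle' : (vStat (partLength mu) mu lam : ℚ) ≤
      ((∑ p : Fin (partLength mu), nStat (lam0.replicate d hd (mu.parts p) (hp p)) : ℕ) : ℚ) := by
    exact_mod_cast hle
  have h2 := two_mul_sum_nStat_add mu fun p => lam0.replicate d hd (mu.parts p) (hp p)
  have h3 : ∀ p : Fin (partLength mu),
      (lam0.replicate d hd (mu.parts p) (hp p)).conjSq = d ^ 2 * lam0.conjSq := fun p =>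
    conjSq_eq_of_ncard (by rw [hp p]; exact Nat.le_mul_of_pos_left m hd)
      fun v hv => ncard_replicate d hd lam0 _ _ hv
  simp only [h3, Finset.sum_const, Finset.card_univ, Fintype.card_fin, nsmul_eq_mul] at h2
  linarith

theorem two_mul_sub_WVal (g k n : ℕ) (μ : Fin k → PartitionOf n) (lam : PartitionOf n) :
    2 * n * (DeltaStat g k μ - WVal g k n μ lam) =
      deltaStat g k μ * ((n : ℚ) ^ 2 - lam.conjSq) + ∑ i, slack (μ i) lam := by
  simp only [DeltaStat, WVal, deltaStat, slack, finsum_parts_sq]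
  rw [Finset.sum_sub_distrib, ← Finset.sum_mul, ← Finset.mul_sum, Finset.sum_sub_distrib,
    Finset.sum_add_distrib, ← Finset.mul_sum, conjSq]
  simp only [Finset.sum_const, Finset.card_univ, Fintype.card_fin, nsmul_eq_mul]
  ring

end PartitionOf

/-- Theorem: if `δ(𝛍) ≥ 0` then `max_{λ ∈ 𝒫ₙ} W(λ) = Δ(𝛍)`, attained at `(1ⁿ)`.
If `δ(𝛍) = 0` and all `μⁱ` are rectangular (with parts `tᵢ`, `t = gcd tᵢ`), the maximum
is attained exactly at unions of `n/t` copies of a single `λ₀ ∈ 𝒫_t`; otherwise only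
at `(1ⁿ)`. -/
theorem stmt_9 (g k n : ℕ) (hk : 1 ≤ k) (hn : 1 ≤ n)
    (μ : Fin k → PartitionOf n) (hδ : 0 ≤ deltaStat g k μ) :
    (∀ lam : PartitionOf n, WVal g k n μ lam ≤ DeltaStat g k μ) ∧
    WVal g k n μ (onesPartition n) = DeltaStat g k μ ∧
    ((deltaStat g k μ = 0 ∧ ∀ i, Rectangular (μ i)) →
      ∀ lam : PartitionOf n,
        (WVal g k n μ lam = DeltaStat g k μ ↔
          ∃ lam0 : PartitionOf (Finset.univ.gcd fun i => (μ i).parts 0),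
            ∀ v, 0 < v → Set.ncard {i | lam.parts i = v}
              = (n / Finset.univ.gcd fun i => (μ i).parts 0) *
                  Set.ncard {i | lam0.parts i = v})) ∧
    (¬ (deltaStat g k μ = 0 ∧ ∀ i, Rectangular (μ i)) →
      ∀ lam : PartitionOf n, WVal g k n μ lam = DeltaStat g k μ →
        lam.parts = (onesPartition n).parts) := by
  have hn0 : 0 < n := hn
  have hnQ : (0 : ℚ) < n := by exact_mod_cast hn0
  have hslack : ∀ lam i, 0 ≤ (μ i).slack lam := fun lam i =>
    (PartitionOf.slack_nonneg_and hn0 (μ i) lam).1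
  have hsum : ∀ lam : PartitionOf n, 0 ≤ ∑ i, (μ i).slack lam := fun lam =>
    Finset.sum_nonneg fun i _ => hslack lam i
  have hid := PartitionOf.two_mul_sub_WVal g k n μ
  have hdefect : ∀ lam : PartitionOf n, 0 ≤ deltaStat g k μ * ((n : ℚ) ^ 2 - lam.conjSq) :=
    fun lam => mul_nonneg hδ (sub_nonneg.mpr lam.conjSq_le)
  have hle : ∀ lam : PartitionOf n, WVal g k n μ lam ≤ DeltaStat g k μ := by
    intro lam
    have h1 : 0 ≤ 2 * n * (DeltaStat g k μ - WVal g k n μ lam) := by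
      rw [hid]
      exact add_nonneg (hdefect lam) (hsum lam)
    exact sub_nonneg.mp (nonneg_of_mul_nonneg_right h1 (by positivity))
  have hge : ∀ lam : PartitionOf n,
      deltaStat g k μ * ((n : ℚ) ^ 2 - lam.conjSq) + ∑ i, (μ i).slack lam ≤ 0 →
        WVal g k n μ lam = DeltaStat g k μ := by
    intro lam h
    rw [← hid] at h
    exact le_antisymm (hle lam)
      (sub_nonpos.mp (nonpos_of_mul_nonpos_right h (by positivity)))
  have heq : ∀ lam : PartitionOf n, WVal g k n μ lam = DeltaStat g k μ →
      lam.conjSq ≠ (n : ℚ) ^ 2 → deltaStat g k μ = 0 ∧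
        ∀ i, Rectangular (μ i) ∧ ∀ j, partLength (μ i) ∣ lam.conj j := by
    intro lam h hne
    have h1 := hid lam
    rw [h, sub_self, mul_zero] at h1
    have h2 := hdefect lam
    have h3 := hsum lam
    refine ⟨?_, fun i => ?_⟩
    · have h4 : deltaStat g k μ * ((n : ℚ) ^ 2 - lam.conjSq) = 0 := by linarith
      exact (mul_eq_zero.mp h4).resolve_right (sub_ne_zero.mpr hne.symm)
    · have h4 : ∑ i, (μ i).slack lam = 0 := by linarith
      have h5 := (Finset.sum_eq_zero_iff_of_nonneg fun i _ => hslack lam i).mp h4 i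
        (Finset.mem_univ i)
      exact (PartitionOf.slack_nonneg_and hn0 (μ i) lam).2 h5 hne
  refine ⟨hle, hge _ ?_, ?_, ?_⟩
  · rw [PartitionOf.conjSq_ones, sub_self, mul_zero, zero_add]
    refine Finset.sum_nonpos fun i _ => ?_
    have h1 : (vStat (partLength (μ i)) (μ i) (onesPartition n) : ℚ) ≤
        ((∑ p : Fin (partLength (μ i)), nStat (onesPartition ((μ i).parts p)) : ℕ) : ℚ) := by
      exact_mod_cast (μ i).vStat_le_ones (onesPartition n)
    have h2 := (μ i).two_mul_sum_nStat_add fun p => onesPartition ((μ i).parts p)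
    simp only [PartitionOf.conjSq_ones] at h2
    rw [PartitionOf.slack, PartitionOf.conjSq_ones, sub_self, mul_zero, zero_sub, ← h2]
    exact neg_nonpos.mpr (mul_nonneg hnQ.le (by linarith))
  · rintro ⟨hδ0, hrect⟩ lam
    set t := Finset.univ.gcd fun i => (μ i).parts 0 with ht
    have htdvd : ∀ i, t ∣ (μ i).parts 0 := fun i => Finset.gcd_dvd (Finset.mem_univ i)
    have hrn : ∀ i, partLength (μ i) * (μ i).parts 0 = n := fun i =>
      PartitionOf.partLength_mul_of_rectangular (hrect i)
    have htn : t ∣ n := (htdvd ⟨0, hk⟩).trans (Dvd.intro_left _ (hrn ⟨0, hk⟩))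
    have htpos : 0 < t := Nat.pos_of_dvd_of_pos htn hn0
    have hen : n = n / t * t := (Nat.div_mul_cancel htn).symm
    have hepos : 0 < n / t := Nat.div_pos (Nat.le_of_dvd hn0 htn) htpos
    constructor
    · intro h
      refine lam.exists_ncard_eq_mul hepos hen fun j => ?_
      by_cases hQ : lam.conjSq = (n : ℚ) ^ 2
      · exact PartitionOf.conj_ones_dvd (lam.parts_eq_ones_of_conjSq_eq hQ)
          (Nat.div_dvd_of_dvd htn) j
      · have h1 : n ∣ lam.conj j * t := by
          rw [ht, ← Finset.normalize_gcd (s := Finset.univ)]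
          have h2 : n ∣ Finset.univ.gcd fun i => lam.conj j * (μ i).parts 0 := by
            refine Finset.dvd_gcd fun i _ => ?_
            conv_lhs => rw [← hrn i]
            exact mul_dvd_mul_right (((heq lam h hQ).2 i).2 j) _
          rw [Finset.gcd_mul_left] at h2
          simpa using h2
        conv_lhs at h1 => rw [hen]
        exact Nat.dvd_of_mul_dvd_mul_right htpos h1
    · rintro ⟨lam0, hlam0⟩
      refine hge _ ?_
      rw [hδ0, zero_mul, zero_add]
      refine Finset.sum_nonpos fun i _ => ?_
      obtain ⟨d, hd⟩ := htdvd i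
      have hd' : (μ i).parts 0 = d * t := by rw [hd, mul_comm]
      have hdpos : 0 < d := by
        have := (μ i).parts_zero_pos hn0
        rw [hd'] at this
        exact Nat.pos_of_mul_pos_right this
      have hrd : n = partLength (μ i) * d * t := by
        rw [mul_assoc, ← hd', hrn i]
      have he : n / t = partLength (μ i) * d := Nat.div_eq_of_eq_mul_left htpos hrd
      have h1 := PartitionOf.vStat_le_of_replicate (hrect i) hdpos hd' fun v hv => by
        rw [← he, hlam0 v hv]
      have h2 := PartitionOf.conjSq_eq_of_ncard (Nat.le_of_dvd hn0 htn) hlam0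
      have h3 : (partLength (μ i) : ℚ) * d * t = n := by
        exact_mod_cast hrd.symm
      rw [PartitionOf.slack, h2, he]
      simp only [PartitionOf.parts_eq_of_rectangular (hrect i), Finset.sum_const,
        Finset.card_univ, Fintype.card_fin, nsmul_eq_mul, hd']
      push_cast
      have h4 := mul_le_mul_of_nonneg_left h1 hnQ.le
      rw [← h3] at h4 ⊢
      linarith
  · intro hnot lam h
    by_contra hne
    have hQ : lam.conjSq ≠ (n : ℚ) ^ 2 := fun hQ => hne (lam.parts_eq_ones_of_conjSq_eq hQ)
    exact hnot ⟨(heq lam h hQ).1, fun i => ((heq lam h hQ).2 i).1⟩
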